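/- arXiv:2310.17309 — 2 statements merged into one kernel-verified Lean document; each statement's English description precedes it below -/
import Mathlib

section
/- [Jackson inequality] Let 0 < σ < p < ∞ and β = 1/σ − 1/p. There exists a constant c such that for all f ∈ V_{σ,p}(S) and all n ≥ 1, the best n-term approximation error in L^p with respect to the dictionary 𝒞 satisfies σ_n(f, 𝒞) ≤ c·n^{−β}·|f|_{V_{σ,p}}. -/
open MeasureTheory ENNReal Set Filter
open scoped ENNReal NNReal Classical

noncomputable section

variable {Ω : Type} [MeasurableSpace Ω]

/-- The data of a filtration on `Ω`, recorded through the (finitely many) atoms of each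
σ-algebra `ℱ_n`. -/
structure FiltrationAtoms (Ω : Type) [MeasurableSpace Ω] (μ : Measure Ω) where
  atoms : ℕ → Set (Set Ω)
  atoms_finite : ∀ n, (atoms n).Finite
  atoms_measurable : ∀ n, ∀ A ∈ atoms n, MeasurableSet A
  atoms_zero : atoms 0 = {Set.univ}
  atoms_disjoint : ∀ n, (atoms n).Pairwise Disjoint
  atoms_cover : ∀ n, ⋃₀ atoms n = Set.univ
  atoms_pos : ∀ n, ∀ A ∈ atoms n, 0 < μ A
  atoms_refine : ∀ n, ∀ B ∈ atoms (n + 1), ∃ A ∈ atoms n, B ⊆ A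

namespace FiltrationAtoms

variable {μ : Measure Ω}

/-- The collection `𝒜` of all atoms of the filtration. -/
def Atoms (F : FiltrationAtoms Ω μ) : Set (Set Ω) := ⋃ n, F.atoms n

/-- A `ν`-ary filtration: every atom of `ℱ_n` is the union of at most `ν` atoms of `ℱ_{n+1}`. -/
def IsNuAry (F : FiltrationAtoms Ω μ) (ν : ℕ) : Prop :=
  ∀ n, ∀ A ∈ F.atoms n, ∃ T : Finset (Set Ω),
    T.card ≤ ν ∧ ↑T ⊆ F.atoms (n + 1) ∧ A = ⋃₀ ↑T

/-- A binary filtration: in the passage from `ℱ_n` to `ℱ_{n+1}`, exactly one atom `A` is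
subdivided into two atoms `A'`, `A''` of positive measure with `μ A' ≤ μ A''`. -/
def IsBinary (F : FiltrationAtoms Ω μ) : Prop :=
  ∀ n, ∃ A ∈ F.atoms n, ∃ A' A'' : Set Ω, A' ∈ F.atoms (n + 1) ∧ A'' ∈ F.atoms (n + 1) ∧
    Disjoint A' A'' ∧ A = A' ∪ A'' ∧ μ A' ≤ μ A'' ∧ 0 < μ A' ∧
    F.atoms (n + 1) = insert A' (insert A'' (F.atoms n \ {A}))

/-- `B` is one of the atoms into which the atom `A` is subdivided. -/
def IsChildOf (F : FiltrationAtoms Ω μ) (B A : Set Ω) : Prop :=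
  ∃ n, A ∈ F.atoms n ∧ B ∈ F.atoms (n + 1) ∧ B ⊂ A

/-- `R` is an atom or a (nonempty) ring, i.e. a difference `A \ B` of two nested atoms. -/
def IsAtomOrRing (F : FiltrationAtoms Ω μ) (R : Set Ω) : Prop :=
  R ∈ F.Atoms ∨ ∃ A ∈ F.Atoms, ∃ B ∈ F.Atoms, B ⊆ A ∧ R = A \ B ∧ R.Nonempty

end FiltrationAtoms

/-- The stability condition on the finite-dimensional space `S`:
there are `c₁, c₂ ∈ (0,1]` with `|{ω ∈ A : |f ω| ≥ c₁ ‖f‖_{L^∞(A)}}| ≥ c₂ |A|` for all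
`f ∈ S` and all atoms `A`. -/
def StabilityCondition {μ : Measure Ω} (F : FiltrationAtoms Ω μ)
    (S : Submodule ℝ (Ω → ℝ)) : Prop :=
  ∃ c₁ ∈ Set.Ioc (0:ℝ) 1, ∃ c₂ ∈ Set.Ioc (0:ℝ) 1,
    ∀ A ∈ F.Atoms, ∀ f ∈ S,
      ENNReal.ofReal c₂ * μ A ≤
        μ {ω | ω ∈ A ∧
          ENNReal.ofReal c₁ * eLpNormEssSup f (μ.restrict A) ≤ ENNReal.ofReal |f ω|}

/-- `E_p(f,R)`: the error of best `L^p(R)`-approximation of `f` by elements of `S` (restricted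
to `R`). -/
def Ep (S : Submodule ℝ (Ω → ℝ)) (p : ℝ) (μ : Measure Ω) (f : Ω → ℝ) (R : Set Ω) : ℝ≥0∞ :=
  ⨅ g ∈ S, eLpNorm (f - g) (ENNReal.ofReal p) (μ.restrict R)

/-- The ring-variation seminorm `|f|_{V_{σ,p}}`: the supremum of
`(∑_{R ∈ P} E_p(f,R)^σ)^{1/σ}` over all finite collections `P` of pairwise disjoint atoms
or rings. -/
def varSeminorm {μ : Measure Ω} (F : FiltrationAtoms Ω μ)
    (S : Submodule ℝ (Ω → ℝ)) (σ p : ℝ) (f : Ω → ℝ) : ℝ≥0∞ :=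
  ⨆ (P : Finset (Set Ω)) (_ : ∀ R ∈ P, F.IsAtomOrRing R)
    (_ : (↑P : Set (Set Ω)).Pairwise Disjoint),
    (∑ R ∈ P, Ep S p μ f R ^ σ) ^ (1 / σ)

/-- The full variation norm `‖f‖_{V_{σ,p}} = ‖f‖_p + |f|_{V_{σ,p}}`. -/
def varNorm {μ : Measure Ω} (F : FiltrationAtoms Ω μ)
    (S : Submodule ℝ (Ω → ℝ)) (σ p : ℝ) (f : Ω → ℝ) : ℝ≥0∞ :=
  eLpNorm f (ENNReal.ofReal p) μ + varSeminorm F S σ p f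

/-- The dictionary `𝒞 = {g·1_A : g ∈ S, A ∈ 𝒜}`. -/
def dictC {μ : Measure Ω} (F : FiltrationAtoms Ω μ) (S : Submodule ℝ (Ω → ℝ)) :
    Set (Ω → ℝ) :=
  {h | ∃ g ∈ S, ∃ A ∈ F.Atoms, h = A.indicator g}

/-- `Σ_n^D`: linear combinations of at most `n` elements of the dictionary `D`. -/
def SigmaN (D : Set (Ω → ℝ)) (n : ℕ) : Set (Ω → ℝ) :=
  {h | ∃ c : Fin n → ℝ, ∃ x : Fin n → Ω → ℝ, (∀ j, x j ∈ D) ∧ h = ∑ j, c j • x j}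

/-- `σ_n(f, D)`: the error of best `n`-term approximation in `L^p` with respect to the
dictionary `D`. -/
def bestApprox (D : Set (Ω → ℝ)) (p : ℝ) (μ : Measure Ω) (f : Ω → ℝ) (n : ℕ) : ℝ≥0∞ :=
  ⨅ y ∈ SigmaN D n, eLpNorm (f - y) (ENNReal.ofReal p) μ

/-- The `ℓ^q` norm (`0 < q ≤ ∞`) of a sequence of extended nonnegative reals. -/
def lqNorm (q : ℝ≥0∞) (a : ℕ → ℝ≥0∞) : ℝ≥0∞ :=
  if q = ∞ then ⨆ n, a n else (∑' n, a n ^ q.toReal) ^ (1 / q.toReal)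

/-- The quasi-norm of the approximation space `𝒜_q^α`:
`‖f‖_p + ‖(2^{nα} σ_{2^n}(f,D))_n‖_{ℓ^q}`. -/
def approxNorm (D : Set (Ω → ℝ)) (p : ℝ) (q : ℝ≥0∞) (α : ℝ) (μ : Measure Ω)
    (f : Ω → ℝ) : ℝ≥0∞ :=
  eLpNorm f (ENNReal.ofReal p) μ +
    lqNorm q (fun n => (2 : ℝ≥0∞) ^ ((n : ℝ) * α) * bestApprox D p μ f (2 ^ n))

/-- Membership in `L^p(S)`, the `L^p`-closure of the span of the dictionary `𝒞`. -/
def MemLpS {μ : Measure Ω} (F : FiltrationAtoms Ω μ) (S : Submodule ℝ (Ω → ℝ)) (p : ℝ)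
    (f : Ω → ℝ) : Prop :=
  AEMeasurable f μ ∧ eLpNorm f (ENNReal.ofReal p) μ ≠ ∞ ∧
    ∀ ε : ℝ≥0∞, 0 < ε → ∃ n, ∃ y ∈ SigmaN (dictC F S) n,
      eLpNorm (f - y) (ENNReal.ofReal p) μ < ε

/-- Membership in the variation space `V_{σ,p}(S)`. -/
def MemVar {μ : Measure Ω} (F : FiltrationAtoms Ω μ) (S : Submodule ℝ (Ω → ℝ)) (σ p : ℝ)
    (f : Ω → ℝ) : Prop :=
  MemLpS F S p f ∧ varSeminorm F S σ p f ≠ ∞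

/-- The K-functional `K(f, t, L^p, Y)` for a subset `Y` of functions with (quasi-)norm
`yNorm`. -/
def Kfun (p : ℝ) (μ : Measure Ω) (Y : Set (Ω → ℝ)) (yNorm : (Ω → ℝ) → ℝ≥0∞)
    (f : Ω → ℝ) (t : ℝ≥0∞) : ℝ≥0∞ :=
  ⨅ g ∈ Y, eLpNorm (f - g) (ENNReal.ofReal p) μ + t * yNorm g

/-- The quasi-norm of the real interpolation space `(L^p, Y)_{θ,q}`, namely
`‖(2^{nθ} K(f, 2^{-n}))_n‖_{ℓ^q}`. -/
def interpNorm (p : ℝ) (μ : Measure Ω) (Y : Set (Ω → ℝ)) (yNorm : (Ω → ℝ) → ℝ≥0∞)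
    (θ : ℝ) (q : ℝ≥0∞) (f : Ω → ℝ) : ℝ≥0∞ :=
  lqNorm q (fun n => (2 : ℝ≥0∞) ^ ((n : ℝ) * θ) *
    Kfun p μ Y yNorm f ((2 : ℝ≥0∞) ^ (-(n : ℝ))))

/-- The modulus of smoothness `𝒲_S(f,t)_{σ,p}`; the supremum ranges over all finite
partitions of `Ω` into pairwise disjoint atoms or rings. -/
def modW {μ : Measure Ω} (F : FiltrationAtoms Ω μ) (S : Submodule ℝ (Ω → ℝ)) (σ p : ℝ)
    (f : Ω → ℝ) (t : ℝ) : ℝ≥0∞ :=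
  ⨆ (P : Finset (Set Ω)) (_ : ∀ R ∈ P, F.IsAtomOrRing R)
    (_ : (↑P : Set (Set Ω)).Pairwise Disjoint) (_ : ⋃₀ (↑P : Set (Set Ω)) = Set.univ),
    min (ENNReal.ofReal t) ((P.card : ℝ≥0∞)⁻¹) ^ (1 / σ - 1 / p) *
      (∑ R ∈ P, Ep S p μ f R ^ σ) ^ (1 / σ)

/-- `h` belongs to `S(ℱ_n)`: on each atom of `ℱ_n`, `h` agrees with some element of `S`. -/
def PiecewiseS {μ : Measure Ω} (F : FiltrationAtoms Ω μ) (S : Submodule ℝ (Ω → ℝ)) (n : ℕ)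
    (h : Ω → ℝ) : Prop :=
  ∀ A ∈ F.atoms n, ∃ g ∈ S, Set.EqOn h g A

/-- The near-best approximation operator `W_μ f = ∑_{A ∈ 𝒜_μ} f_A · 1_A` built from a
selection `fA` of near-best approximants on atoms. -/
def Wop {μ : Measure Ω} (F : FiltrationAtoms Ω μ) (fA : (Ω → ℝ) → Set Ω → Ω → ℝ)
    (f : Ω → ℝ) (n : ℕ) : Ω → ℝ :=
  ∑ A ∈ (F.atoms_finite n).toFinset, A.indicator (fA f A)

end

section Dictionary

variable {Ω : Type}

theorem zero_mem_SigmaN {D : Set (Ω → ℝ)} (hD : (0 : Ω → ℝ) ∈ D) (n : ℕ) :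
    (0 : Ω → ℝ) ∈ SigmaN D n :=
  ⟨0, fun _ => 0, fun _ => hD, by simp⟩

theorem add_mem_SigmaN {D : Set (Ω → ℝ)} {m n : ℕ} {y z : Ω → ℝ}
    (hy : y ∈ SigmaN D m) (hz : z ∈ SigmaN D n) : y + z ∈ SigmaN D (m + n) := by
  obtain ⟨c, x, hx, rfl⟩ := hy
  obtain ⟨d, w, hw, rfl⟩ := hz
  refine ⟨Fin.append c d, Fin.append x w, ?_, ?_⟩
  · intro j
    refine Fin.addCases (fun i => ?_) (fun i => ?_) j
    · simpa using hx i
    · simpa using hw i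
  · simp [Fin.sum_univ_add]

theorem SigmaN_mono {D : Set (Ω → ℝ)} (hD : (0 : Ω → ℝ) ∈ D) {m n : ℕ} (h : m ≤ n) :
    SigmaN D m ⊆ SigmaN D n := by
  intro y hy
  obtain ⟨k, rfl⟩ := Nat.exists_eq_add_of_le h
  simpa using add_mem_SigmaN hy (zero_mem_SigmaN hD k)

theorem smul_mem_SigmaN_one {D : Set (Ω → ℝ)} {y : Ω → ℝ} (hy : y ∈ D) (a : ℝ) :
    a • y ∈ SigmaN D 1 :=
  ⟨fun _ => a, fun _ => y, fun _ => hy, by simp⟩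

end Dictionary

section Atoms

variable {Ω : Type} [MeasurableSpace Ω] {μ : Measure Ω} (F : FiltrationAtoms Ω μ)

theorem FiltrationAtoms.univ_mem_Atoms : (Set.univ : Set Ω) ∈ F.Atoms :=
  Set.mem_iUnion.2 ⟨0, by simp [F.atoms_zero]⟩

theorem FiltrationAtoms.measurableSet_of_mem_Atoms {A : Set Ω} (hA : A ∈ F.Atoms) :
    MeasurableSet A := by
  obtain ⟨n, hn⟩ := Set.mem_iUnion.1 hA
  exact F.atoms_measurable n A hn

theorem FiltrationAtoms.subset_or_disjoint {m n : ℕ} (hmn : m ≤ n) {A B : Set Ω}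
    (hA : A ∈ F.atoms n) (hB : B ∈ F.atoms m) : A ⊆ B ∨ Disjoint A B := by
  induction n, hmn using Nat.le_induction generalizing A with
  | base =>
    by_cases h : A = B
    · exact Or.inl h.subset
    · exact Or.inr (F.atoms_disjoint m hA hB h)
  | succ n _ ih =>
    obtain ⟨A', hA', hAA'⟩ := F.atoms_refine n A hA
    exact (ih hA').imp hAA'.trans fun h => h.mono_left hAA'

theorem zero_mem_dictC (S : Submodule ℝ (Ω → ℝ)) : (0 : Ω → ℝ) ∈ dictC F S :=
  ⟨0, S.zero_mem, Set.univ, F.univ_mem_Atoms, by simp⟩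

theorem indicator_mem_dictC {S : Submodule ℝ (Ω → ℝ)} {g : Ω → ℝ} (hg : g ∈ S) {A : Set Ω}
    (hA : A ∈ F.Atoms) : A.indicator g ∈ dictC F S :=
  ⟨g, hg, A, hA, rfl⟩

/-- A combination of dictionary elements is piecewise in `S` from some level on. -/
theorem exists_piecewiseS_of_mem_SigmaN (S : Submodule ℝ (Ω → ℝ)) {n : ℕ} {y : Ω → ℝ}
    (hy : y ∈ SigmaN (dictC F S) n) : ∃ m, PiecewiseS F S m y := by
  obtain ⟨c, x, hx, rfl⟩ := hy
  choose g hg B hB hxB using hx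
  choose l hl using fun j => Set.mem_iUnion.1 (hB j)
  refine ⟨Finset.univ.sup l, fun A hA => ?_⟩
  refine ⟨∑ j, if A ⊆ B j then c j • g j else 0, S.sum_mem fun j _ => ?_, fun ω hω => ?_⟩
  · split_ifs
    · exact S.smul_mem _ (hg j)
    · exact S.zero_mem
  · simp only [Finset.sum_apply]
    refine Finset.sum_congr rfl fun j _ => ?_
    rcases F.subset_or_disjoint (Finset.le_sup (f := l) (Finset.mem_univ j)) hA (hl j) with h | h
    · simp [hxB j, h, h hω]
    · have hωB : ω ∉ B j := Set.disjoint_left.1 h hω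
      have hAB : ¬ A ⊆ B j := fun h' => hωB (h' hω)
      simp [hxB j, hAB, hωB]

end Atoms

section LocalError

variable {Ω : Type} [MeasurableSpace Ω] {μ : Measure Ω}

theorem Ep_empty (S : Submodule ℝ (Ω → ℝ)) (p : ℝ) (f : Ω → ℝ) : Ep S p μ f ∅ = 0 := by
  refine le_antisymm (iInf₂_le_of_le 0 S.zero_mem ?_) bot_le
  simp

/-- For `f` in the closure of the span of the dictionary, the local errors on the atoms of a
sufficiently fine level are uniformly small. -/
theorem exists_level_Ep_le (F : FiltrationAtoms Ω μ) (S : Submodule ℝ (Ω → ℝ)) {p : ℝ}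
    {f : Ω → ℝ} (hf : MemLpS F S p f) {ε : ℝ≥0∞} (hε : 0 < ε) :
    ∃ m, ∀ A ∈ F.atoms m, Ep S p μ f A ≤ ε := by
  obtain ⟨n, y, hy, hfy⟩ := hf.2.2 ε hε
  obtain ⟨m, hm⟩ := exists_piecewiseS_of_mem_SigmaN F S hy
  refine ⟨m, fun A hA => ?_⟩
  obtain ⟨g, hg, hyg⟩ := hm A hA
  refine (iInf₂_le g hg).trans ?_
  have hae : f - g =ᵐ[μ.restrict A] f - y := by
    filter_upwards [ae_restrict_mem (F.atoms_measurable m A hA)] with ω hω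
    simp [hyg hω]
  rw [eLpNorm_congr_ae hae]
  exact (eLpNorm_mono_measure _ Measure.restrict_le_self).trans hfy.le

/-- `f` can be approximated on `R` by a combination of `M` dictionary elements supported in `R`,
with `p`-th power error at most `M * η ^ p`. -/
def HasApprox (F : FiltrationAtoms Ω μ) (S : Submodule ℝ (Ω → ℝ)) (p : ℝ) (f : Ω → ℝ)
    (η : ℝ≥0∞) (R : Set Ω) (M : ℕ) : Prop :=
  ∃ y ∈ SigmaN (dictC F S) M, (∀ ω ∉ R, y ω = 0) ∧
    ∫⁻ ω in R, ‖f ω - y ω‖ₑ ^ p ∂μ ≤ M * η ^ p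

/-- There are `N` pairwise disjoint atoms or rings inside `R` on which the local error of `f`
exceeds `ε`. -/
def HasBadSets (F : FiltrationAtoms Ω μ) (S : Submodule ℝ (Ω → ℝ)) (p : ℝ) (f : Ω → ℝ)
    (ε : ℝ≥0∞) (R : Set Ω) (N : ℕ) : Prop :=
  ∃ P : Finset (Set Ω), P.card = N ∧
    (∀ Q ∈ P, F.IsAtomOrRing Q ∧ ε < Ep S p μ f Q ∧ Q ⊆ R) ∧
    (↑P : Set (Set Ω)).Pairwise Disjoint

variable {F : FiltrationAtoms Ω μ} {S : Submodule ℝ (Ω → ℝ)} {p : ℝ} {f : Ω → ℝ}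
  {ε η : ℝ≥0∞} {R R' : Set Ω} {M M' N N' : ℕ}

theorem HasApprox.empty : HasApprox F S p f η ∅ 0 :=
  ⟨0, zero_mem_SigmaN (zero_mem_dictC F S) 0, by simp, by simp⟩

theorem HasApprox.union (hR : MeasurableSet R) (hR' : MeasurableSet R') (hd : Disjoint R R')
    (h : HasApprox F S p f η R M) (h' : HasApprox F S p f η R' M') :
    HasApprox F S p f η (R ∪ R') (M + M') := by
  obtain ⟨y, hy, hy0, hyM⟩ := h
  obtain ⟨z, hz, hz0, hzM⟩ := h'
  refine ⟨y + z, add_mem_SigmaN hy hz, fun ω hω => ?_, ?_⟩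
  · rw [Set.mem_union, not_or] at hω
    simp [hy0 ω hω.1, hz0 ω hω.2]
  · rw [lintegral_union hR' hd]
    have h1 : ∫⁻ ω in R, ‖f ω - (y + z) ω‖ₑ ^ p ∂μ = ∫⁻ ω in R, ‖f ω - y ω‖ₑ ^ p ∂μ :=
      setLIntegral_congr_fun hR fun ω hω => by
        simp [hz0 ω (Set.disjoint_left.1 hd hω)]
    have h2 : ∫⁻ ω in R', ‖f ω - (y + z) ω‖ₑ ^ p ∂μ = ∫⁻ ω in R', ‖f ω - z ω‖ₑ ^ p ∂μ :=
      setLIntegral_congr_fun hR' fun ω hω => by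
        simp [hy0 ω (Set.disjoint_right.1 hd hω)]
    rw [h1, h2, Nat.cast_add, add_mul]
    exact add_le_add hyM hzM

theorem HasApprox.sUnion {T : Finset (Set Ω)} (hT : ∀ A ∈ T, MeasurableSet A)
    (hd : (↑T : Set (Set Ω)).Pairwise Disjoint) {m : Set Ω → ℕ}
    (h : ∀ A ∈ T, HasApprox F S p f η A (m A)) :
    HasApprox F S p f η (⋃₀ ↑T) (∑ A ∈ T, m A) := by
  induction T using Finset.induction_on with
  | empty => simpa using HasApprox.empty
  | insert A T hA ih =>
    rw [Finset.sum_insert hA, Finset.coe_insert, Set.sUnion_insert]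
    simp only [Finset.mem_insert, forall_eq_or_imp] at hT h
    refine HasApprox.union hT.1 (T.finite_toSet.measurableSet_sUnion hT.2) ?_ h.1
      (ih hT.2 (hd.mono (by simp)) h.2)
    refine Set.disjoint_sUnion_right.2 fun B hB => hd (by simp) (by simp [Finset.mem_coe.1 hB]) ?_
    rintro rfl
    exact hA hB

theorem setLIntegral_rpow_le_of_eLpNorm_le (hp : 0 < p) {g : Ω → ℝ}
    (hg : eLpNorm (f - g) (ENNReal.ofReal p) (μ.restrict R) ≤ η) :
    ∫⁻ ω in R, ‖f ω - g ω‖ₑ ^ p ∂μ ≤ η ^ p := by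
  rw [eLpNorm_eq_lintegral_rpow_enorm_toReal (by simpa using hp) ENNReal.ofReal_ne_top,
    ENNReal.toReal_ofReal hp.le, one_div] at hg
  exact (ENNReal.rpow_inv_le_iff hp).1 hg

/-- On a difference of two atoms, and in particular on a ring, a small local error yields an
approximation by two dictionary elements. -/
theorem HasApprox.of_Ep_le_diff (hp : 0 < p) (hεη : ε < η) {A B : Set Ω} (hA : A ∈ F.Atoms)
    (hB : B ∈ F.Atoms) (hBA : B ⊆ A) (hE : Ep S p μ f (A \ B) ≤ ε) :
    HasApprox F S p f η (A \ B) 2 := by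
  obtain ⟨g, hg, hgη⟩ :
      ∃ g ∈ S, eLpNorm (f - g) (ENNReal.ofReal p) (μ.restrict (A \ B)) < η := by
    simpa only [Ep, iInf_lt_iff, exists_prop] using hE.trans_lt hεη
  refine ⟨(1 : ℝ) • A.indicator g + (-1 : ℝ) • B.indicator g,
    add_mem_SigmaN (smul_mem_SigmaN_one (indicator_mem_dictC F hg hA) 1)
      (smul_mem_SigmaN_one (indicator_mem_dictC F hg hB) (-1)), fun ω hω => ?_, ?_⟩
  · by_cases hωB : ω ∈ B
    · simp [hωB, hBA hωB]
    · have hωA : ω ∉ A := fun h => hω ⟨h, hωB⟩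
      simp [hωA, hωB]
  · have h1 :
        ∫⁻ ω in A \ B, ‖f ω - ((1 : ℝ) • A.indicator g + (-1 : ℝ) • B.indicator g) ω‖ₑ ^ p ∂μ =
          ∫⁻ ω in A \ B, ‖f ω - g ω‖ₑ ^ p ∂μ :=
      setLIntegral_congr_fun ((F.measurableSet_of_mem_Atoms hA).diff
        (F.measurableSet_of_mem_Atoms hB)) fun ω hω => by simp [hω.1, hω.2]
    rw [h1]
    exact (setLIntegral_rpow_le_of_eLpNorm_le hp hgη.le).trans
      (le_mul_of_one_le_left bot_le (by norm_num))

theorem HasApprox.of_Ep_le (hp : 0 < p) (hεη : ε < η) {A : Set Ω} (hA : A ∈ F.Atoms)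
    (hE : Ep S p μ f A ≤ ε) : HasApprox F S p f η A 1 := by
  obtain ⟨g, hg, hgη⟩ : ∃ g ∈ S, eLpNorm (f - g) (ENNReal.ofReal p) (μ.restrict A) < η := by
    simpa only [Ep, iInf_lt_iff, exists_prop] using hE.trans_lt hεη
  refine ⟨(1 : ℝ) • A.indicator g, smul_mem_SigmaN_one (indicator_mem_dictC F hg hA) 1,
    fun ω hω => by simp [hω], ?_⟩
  have h1 : ∫⁻ ω in A, ‖f ω - ((1 : ℝ) • A.indicator g) ω‖ₑ ^ p ∂μ
      = ∫⁻ ω in A, ‖f ω - g ω‖ₑ ^ p ∂μ :=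
    setLIntegral_congr_fun (F.measurableSet_of_mem_Atoms hA) fun ω hω => by simp [hω]
  rw [h1]
  simpa using setLIntegral_rpow_le_of_eLpNorm_le hp hgη.le

theorem HasBadSets.zero : HasBadSets F S p f ε R 0 := ⟨∅, by simp⟩

theorem HasBadSets.singleton (hR : F.IsAtomOrRing R) (hE : ε < Ep S p μ f R) :
    HasBadSets F S p f ε R 1 :=
  ⟨{R}, by simp, by simp [hR, hE], by simp⟩

theorem HasBadSets.mono (hRR' : R ⊆ R') (h : HasBadSets F S p f ε R N) :
    HasBadSets F S p f ε R' N := by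
  obtain ⟨P, hPN, hP, hd⟩ := h
  exact ⟨P, hPN, fun Q hQ => ⟨(hP Q hQ).1, (hP Q hQ).2.1, (hP Q hQ).2.2.trans hRR'⟩, hd⟩

theorem HasBadSets.union (hd : Disjoint R R') (h : HasBadSets F S p f ε R N)
    (h' : HasBadSets F S p f ε R' N') : HasBadSets F S p f ε (R ∪ R') (N + N') := by
  obtain ⟨P, rfl, hP, hPd⟩ := h
  obtain ⟨P', rfl, hP', hPd'⟩ := h'
  have hcross : ∀ Q ∈ P, ∀ Q' ∈ P', Disjoint Q Q' := fun Q hQ Q' hQ' =>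
    hd.mono (hP Q hQ).2.2 (hP' Q' hQ').2.2
  refine ⟨P ∪ P', Finset.card_union_of_disjoint (Finset.disjoint_left.2 fun Q hQ hQ' => ?_),
    fun Q hQ => ?_, ?_⟩
  · have hQ0 : Q = ∅ := disjoint_self.1 (hcross Q hQ Q hQ')
    have hE := (hP Q hQ).2.1
    rw [hQ0, Ep_empty] at hE
    exact not_lt_bot hE
  · rcases Finset.mem_union.1 hQ with hQ | hQ
    · exact ⟨(hP Q hQ).1, (hP Q hQ).2.1, (hP Q hQ).2.2.trans Set.subset_union_left⟩
    · exact ⟨(hP' Q hQ).1, (hP' Q hQ).2.1, (hP' Q hQ).2.2.trans Set.subset_union_right⟩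
  · rw [Finset.coe_union, Set.pairwise_union_of_symm]
    exact ⟨hPd, hPd', fun Q hQ Q' hQ' _ => hcross Q hQ Q' hQ'⟩

theorem HasBadSets.sUnion {T : Finset (Set Ω)}
    (hd : (↑T : Set (Set Ω)).Pairwise Disjoint) {n : Set Ω → ℕ}
    (h : ∀ A ∈ T, HasBadSets F S p f ε A (n A)) :
    HasBadSets F S p f ε (⋃₀ ↑T) (∑ A ∈ T, n A) := by
  induction T using Finset.induction_on with
  | empty => simpa using HasBadSets.zero
  | insert A T hA ih =>
    rw [Finset.sum_insert hA, Finset.coe_insert, Set.sUnion_insert]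
    simp only [Finset.mem_insert, forall_eq_or_imp] at h
    refine HasBadSets.union ?_ h.1 (ih (hd.mono (by simp)) h.2)
    refine Set.disjoint_sUnion_right.2 fun B hB => hd (by simp) (by simp [Finset.mem_coe.1 hB]) ?_
    rintro rfl
    exact hA hB

theorem HasBadSets.mul_rpow_le {σ : ℝ} (hσ : 0 < σ) (h : HasBadSets F S p f ε R N) :
    N * ε ^ σ ≤ varSeminorm F S σ p f ^ σ := by
  obtain ⟨P, rfl, hP, hd⟩ := h
  have hV : (∑ Q ∈ P, Ep S p μ f Q ^ σ) ^ (1 / σ) ≤ varSeminorm F S σ p f :=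
    le_iSup_of_le P (le_iSup₂_of_le (fun Q hQ => (hP Q hQ).1) hd le_rfl)
  rw [one_div, ENNReal.rpow_inv_le_iff hσ] at hV
  refine le_trans ?_ hV
  rw [← nsmul_eq_mul]
  exact Finset.card_nsmul_le_sum _ _ _ fun Q hQ => ENNReal.rpow_le_rpow (hP Q hQ).2.1.le hσ.le

end LocalError

section Tree

variable {Ω : Type} [MeasurableSpace Ω] {μ : Measure Ω}

/-- `A` has an inner atom `B` such that the local error on `A \ B` is at most `ε` and `f` is
approximated on `B` by few dictionary elements compared to the number of disjoint sets inside `B`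
with local error exceeding `ε`. -/
def HasCore (F : FiltrationAtoms Ω μ) (ν : ℕ) (S : Submodule ℝ (Ω → ℝ)) (p : ℝ) (f : Ω → ℝ)
    (ε η : ℝ≥0∞) (A : Set Ω) : Prop :=
  ∃ B ∈ F.Atoms, B ⊆ A ∧ Ep S p μ f (A \ B) ≤ ε ∧ ∃ M N : ℕ,
    M + (ν + 2) ≤ (2 * ν + 2) * N ∧ HasApprox F S p f η B M ∧ HasBadSets F S p f ε B N

variable {F : FiltrationAtoms Ω μ} {ν : ℕ} {S : Submodule ℝ (Ω → ℝ)} {p : ℝ} {f : Ω → ℝ}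
  {ε η : ℝ≥0∞} {A : Set Ω}

theorem HasApprox.of_subset {B : Set Ω} {M : ℕ} (hp : 0 < p) (hεη : ε < η) (hA : A ∈ F.Atoms)
    (hB : B ∈ F.Atoms) (hBA : B ⊆ A) (hE : Ep S p μ f (A \ B) ≤ ε)
    (hM : HasApprox F S p f η B M) : HasApprox F S p f η A (M + 2) := by
  have hu := hM.union (F.measurableSet_of_mem_Atoms hB)
    ((F.measurableSet_of_mem_Atoms hA).diff (F.measurableSet_of_mem_Atoms hB))
    Set.disjoint_sdiff_right (HasApprox.of_Ep_le_diff hp hεη hA hB hBA hE)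
  rwa [Set.union_sdiff_cancel hBA] at hu

/-- The property `HasCore` passes from the children of an atom to the atom itself. -/
theorem hasCore_of_children (hp : 0 < p) (hεη : ε < η) (hA : A ∈ F.Atoms)
    (hAε : ε < Ep S p μ f A) {T : Finset (Set Ω)} (hTν : T.card ≤ ν) (hT : ↑T ⊆ F.Atoms)
    (hd : (↑T : Set (Set Ω)).Pairwise Disjoint) (hAT : A = ⋃₀ ↑T)
    (hcore : ∀ B ∈ T, ε < Ep S p μ f B → HasCore F ν S p f ε η B) :
    HasCore F ν S p f ε η A := by
  have key : ∀ B ∈ T, ∃ (K : Set Ω) (m n : ℕ), K ⊆ B ∧ HasApprox F S p f η B m ∧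
      HasBadSets F S p f ε K n ∧
      if ε < Ep S p μ f B then m + ν ≤ (2 * ν + 2) * n ∧ K ∈ F.Atoms ∧
        ∃ M, M + (ν + 2) ≤ (2 * ν + 2) * n ∧ HasApprox F S p f η K M
      else m = 1 ∧ n = 0 := by
    intro B hB
    split_ifs with hBε
    · obtain ⟨K, hK, hKB, hE, M, N, hMN, hM, hN⟩ := hcore B hB hBε
      exact ⟨K, M + 2, N, hKB, hM.of_subset hp hεη (hT hB) hK hKB hE, hN, by omega, hK, M, hMN, hM⟩
    · exact ⟨B, 1, 0, subset_rfl, HasApprox.of_Ep_le hp hεη (hT hB) (not_lt.1 hBε),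
        HasBadSets.zero, rfl, rfl⟩
  choose! K m n hKB hm hn hmn using key
  have hself : Ep S p μ f (A \ A) ≤ ε := by simp [Ep_empty]
  have hM := HasApprox.sUnion (fun B hB => F.measurableSet_of_mem_Atoms (hT hB)) hd hm
  have hN := HasBadSets.sUnion hd fun B hB => (hn B hB).mono (hKB B hB)
  rw [← hAT] at hM hN
  set k := (T.filter fun B => ε < Ep S p μ f B).card with hk
  have hsum : ∑ B ∈ T, m B + (ν + 1) * k ≤ (2 * ν + 2) * ∑ B ∈ T, n B + T.card := by
    rw [hk, Finset.card_filter, Finset.mul_sum, Finset.mul_sum, Finset.card_eq_sum_ones,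
      ← Finset.sum_add_distrib, ← Finset.sum_add_distrib]
    refine Finset.sum_le_sum fun B hB => ?_
    have := hmn B hB
    split_ifs at this ⊢ <;> omega
  have hn0 : ∀ B ∈ T, ¬ ε < Ep S p μ f B → n B = 0 := fun B hB hBε => by
    have := hmn B hB
    rw [if_neg hBε] at this
    exact this.2
  rcases Nat.lt_trichotomy k 1 with hk1 | hk1 | hk1
  · refine ⟨A, hA, subset_rfl, hself, _, 1, ?_, hM, HasBadSets.singleton (Or.inl hA) hAε⟩
    have hk0 : k = 0 := by omega
    have hs : ∑ B ∈ T, n B = 0 := Finset.sum_eq_zero fun B hB =>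
      hn0 B hB (Finset.filter_eq_empty_iff.1 (Finset.card_eq_zero.1 (hk.symm.trans hk0)) hB)
    rw [hs, hk0] at hsum
    omega
  · obtain ⟨C, hC⟩ := Finset.card_eq_one.1 (hk.symm.trans hk1)
    have hmemC : ∀ B, B ∈ T ∧ ε < Ep S p μ f B ↔ B = C := fun B => by
      rw [← Finset.mem_filter (p := fun B => ε < Ep S p μ f B), hC, Finset.mem_singleton]
    obtain ⟨hCT, hCε⟩ := (hmemC C).2 rfl
    have hs : ∑ B ∈ T, n B = n C := Finset.sum_eq_single_of_mem C hCT fun B hB hBC =>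
      hn0 B hB fun hBε => hBC ((hmemC B).1 ⟨hB, hBε⟩)
    have hC' := hmn C hCT
    rw [if_pos hCε] at hC'
    obtain ⟨-, hKC, M, hMN, hKM⟩ := hC'
    have hKA : K C ⊆ A := (hKB C hCT).trans (hAT ▸ Set.subset_sUnion_of_mem hCT)
    rcases le_or_gt (Ep S p μ f (A \ K C)) ε with hE | hE
    · exact ⟨K C, hKC, hKA, hE, M, n C, hMN, hKM, hn C hCT⟩
    · have hne : (A \ K C).Nonempty := by
        rw [Set.nonempty_iff_ne_empty]
        intro h0
        rw [h0, Ep_empty] at hE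
        exact not_lt_bot hE
      have hring : F.IsAtomOrRing (A \ K C) := Or.inr ⟨A, hA, K C, hKC, hKA, rfl, hne⟩
      have hN' := (hn C hCT).union Set.disjoint_sdiff_right (HasBadSets.singleton hring hE)
      rw [Set.union_sdiff_cancel hKA] at hN'
      refine ⟨A, hA, subset_rfl, hself, _, _, ?_, hM, hN'⟩
      rw [hs, hk1] at hsum
      rw [mul_add]
      omega
  · refine ⟨A, hA, subset_rfl, hself, _, _, ?_, hM, hN⟩
    obtain ⟨j, hj⟩ := Nat.exists_eq_add_of_lt hk1
    rw [hj] at hsum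
    nlinarith

theorem hasCore_of_lt_Ep (hp : 0 < p) (hεη : ε < η) (hFν : F.IsNuAry ν) {m : ℕ}
    (hm : ∀ B ∈ F.atoms m, Ep S p μ f B ≤ ε) {l : ℕ} (hl : l ≤ m) :
    ∀ A ∈ F.atoms l, ε < Ep S p μ f A → HasCore F ν S p f ε η A := by
  induction hl using Nat.decreasingInduction with
  | self => exact fun A hA hAε => absurd hAε (not_lt.2 (hm A hA))
  | of_succ l _ ih =>
    intro A hA hAε
    obtain ⟨T, hTν, hT, hAT⟩ := hFν l A hA
    exact hasCore_of_children hp hεη (Set.mem_iUnion.2 ⟨l, hA⟩) hAε hTν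
      (hT.trans (Set.subset_iUnion F.atoms (l + 1))) ((F.atoms_disjoint (l + 1)).mono hT) hAT
      fun B hB => ih B (hT hB)

end Tree

section Jackson

variable {Ω : Type} [MeasurableSpace Ω] {μ : Measure Ω} {F : FiltrationAtoms Ω μ}
  {S : Submodule ℝ (Ω → ℝ)} {p : ℝ} {f : Ω → ℝ}

theorem Ep_univ_le_varSeminorm {σ : ℝ} (hσ : 0 < σ) :
    Ep S p μ f Set.univ ≤ varSeminorm F S σ p f := by
  refine le_iSup_of_le {Set.univ} (le_iSup₂_of_le ?_ ?_ ?_)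
  · exact fun Q hQ => Finset.mem_singleton.1 hQ ▸ Or.inl F.univ_mem_Atoms
  · simp
  · rw [Finset.sum_singleton, one_div, ENNReal.rpow_rpow_inv hσ.ne']

theorem bestApprox_le_Ep_univ {n : ℕ} (hn : 1 ≤ n) :
    bestApprox (dictC F S) p μ f n ≤ Ep S p μ f Set.univ := by
  refine le_iInf₂ fun g hg => iInf₂_le_of_le g ?_ (by simp)
  have h1 := smul_mem_SigmaN_one (D := dictC F S) (y := g)
    ⟨g, hg, Set.univ, F.univ_mem_Atoms, by simp⟩ 1
  rw [one_smul] at h1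
  exact SigmaN_mono (zero_mem_dictC F S) hn h1

theorem HasApprox.bestApprox_le {η : ℝ≥0∞} {M n : ℕ} (hp : 0 < p) (hMn : M ≤ n)
    (h : HasApprox F S p f η Set.univ M) :
    bestApprox (dictC F S) p μ f n ≤ (n : ℝ≥0∞) ^ (1 / p) * η := by
  obtain ⟨y, hy, -, hyM⟩ := h
  refine iInf₂_le_of_le y (SigmaN_mono (zero_mem_dictC F S) hMn hy) ?_
  rw [Measure.restrict_univ] at hyM
  rw [eLpNorm_eq_lintegral_rpow_enorm_toReal (by simpa using hp) ENNReal.ofReal_ne_top,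
    ENNReal.toReal_ofReal hp.le, one_div, ENNReal.rpow_inv_le_iff hp,
    ENNReal.mul_rpow_of_nonneg _ _ hp.le, ENNReal.rpow_inv_rpow hp.ne']
  refine hyM.trans ?_
  gcongr

end Jackson

/-- **Jackson inequality.** For `0 < σ < p < ∞` and `β = 1/σ - 1/p` there is a
constant `c` such that `σ_n(f, 𝒞) ≤ c n^{-β} |f|_{V_{σ,p}}` for all `f ∈ V_{σ,p}(S)` and all
`n ≥ 1`. -/
theorem statement1
    {Ω : Type} [MeasurableSpace Ω] {μ : Measure Ω} [IsProbabilityMeasure μ]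
    (F : FiltrationAtoms Ω μ) (ν : ℕ) (hν : 2 ≤ ν) (hFν : F.IsNuAry ν)
    (S : Submodule ℝ (Ω → ℝ)) (hSfin : Module.Finite ℝ S)
    (hSmeas : ∀ g ∈ S, Measurable g) (hSbdd : ∀ g ∈ S, eLpNormEssSup g μ ≠ ∞)
    (hstab : StabilityCondition F S)
    (σ p : ℝ) (hσ : 0 < σ) (hσp : σ < p) :
    ∃ c : ℝ≥0∞, c ≠ ∞ ∧ ∀ f : Ω → ℝ, MemVar F S σ p f → ∀ n : ℕ, 1 ≤ n →
      bestApprox (dictC F S) p μ f n ≤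
        c * (n : ℝ≥0∞) ^ (-(1 / σ - 1 / p)) * varSeminorm F S σ p f := by
  have hp : 0 < p := hσ.trans hσp
  set C : ℝ≥0∞ := 2 * (ν : ℝ≥0∞) + 2 with hC
  have hC0 : C ≠ 0 := by simp [hC]
  have hCtop : C ≠ ∞ := by finiteness
  refine ⟨2 * C ^ (1 / σ), by finiteness, fun f hf n hn => ?_⟩
  have hn0 : (n : ℝ≥0∞) ≠ 0 := by simpa using Nat.one_le_iff_ne_zero.1 hn
  have hntop : (n : ℝ≥0∞) ≠ ∞ := ENNReal.natCast_ne_top n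
  set V := varSeminorm F S σ p f with hV
  have hVtop : V ≠ ∞ := hf.2
  have hEV : Ep S p μ f Set.univ ≤ V := Ep_univ_le_varSeminorm hσ
  rcases eq_or_ne V 0 with hV0 | hV0
  · exact (bestApprox_le_Ep_univ hn).trans (hEV.trans (hV0.le.trans bot_le))
  set ε : ℝ≥0∞ := (C / n) ^ (1 / σ) * V with hε
  have hCn0 : C / n ≠ 0 := ENNReal.div_ne_zero.2 ⟨hC0, hntop⟩
  have hCntop : C / n ≠ ∞ := ENNReal.div_ne_top hCtop hn0
  have hε0 : ε ≠ 0 := mul_ne_zero ((ENNReal.rpow_pos (pos_iff_ne_zero.2 hCn0) hCntop).ne') hV0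
  have hεtop : ε ≠ ∞ := by finiteness
  have hεη : ε < 2 * ε := by
    rw [two_mul]
    exact ENNReal.lt_add_right hεtop hε0
  have hbound : (n : ℝ≥0∞) ^ (1 / p) * (2 * ε) =
      2 * C ^ (1 / σ) * (n : ℝ≥0∞) ^ (-(1 / σ - 1 / p)) * V := by
    rw [hε, ENNReal.div_rpow_of_nonneg _ _ (by positivity), neg_sub,
      ENNReal.rpow_sub _ _ hn0 hntop]
    simp only [div_eq_mul_inv]
    ring
  rw [← hbound]
  obtain ⟨m, hm⟩ := exists_level_Ep_le F S hf.1 (pos_iff_ne_zero.2 hε0)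
  have huniv : (Set.univ : Set Ω) ∈ F.atoms 0 := by simp [F.atoms_zero]
  rcases le_or_gt (Ep S p μ f Set.univ) ε with hE | hE
  · exact (HasApprox.of_Ep_le hp hεη F.univ_mem_Atoms hE).bestApprox_le hp hn
  · obtain ⟨B, hB, hBA, hEB, M, N, hMN, hM, hN⟩ :=
      hasCore_of_lt_Ep hp hεη hFν hm (Nat.zero_le m) _ huniv hE
    refine (hM.of_subset hp hεη F.univ_mem_Atoms hB hBA hEB).bestApprox_le hp ?_
    have hNV := hN.mul_rpow_le hσ
    rw [hε, ENNReal.mul_rpow_of_nonneg _ _ hσ.le, one_div, ENNReal.rpow_inv_rpow hσ.ne',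
      ← mul_assoc, ← hV] at hNV
    have hNC : (N : ℝ≥0∞) * (C / n) ≤ 1 := by
      refine (ENNReal.mul_le_mul_iff_left (c := V ^ σ) ?_ ?_).1 (by simpa using hNV)
      · exact (ENNReal.rpow_pos (pos_iff_ne_zero.2 hV0) hVtop).ne'
      · exact ENNReal.rpow_ne_top_of_nonneg hσ.le hVtop
    rw [← mul_div_assoc, ENNReal.div_le_iff hn0 hntop, one_mul] at hNC
    have hNn : N * (2 * ν + 2) ≤ n := by
      rw [hC] at hNC
      exact_mod_cast hNC
    rw [mul_comm] at hMN
    omega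
end

section
/- [Bernstein inequality] Let 0 < σ < p < ∞ and β = 1/σ − 1/p. There exists a constant c > 0 such that for every n ≥ 1 and every g ∈ Σ_n^𝒞 (i.e., every linear combination of at most n elements of the dictionary 𝒞), one has |g|_{V_{σ,p}} ≤ c·n^β·‖g‖_p. -/
open MeasureTheory ENNReal Set Filter
open scoped ENNReal NNReal Classical

namespace FiltrationAtoms

variable {Ω : Type} [MeasurableSpace Ω] {μ : Measure Ω}

theorem subset_or_disjoint_of_le (F : FiltrationAtoms Ω μ) {m n : ℕ} (hmn : m ≤ n)
    {A B : Set Ω} (hA : A ∈ F.atoms m) (hB : B ∈ F.atoms n) : B ⊆ A ∨ Disjoint B A := by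
  induction n, hmn using Nat.le_induction generalizing B with
  | base =>
    by_cases h : B = A
    · exact Or.inl h.subset
    · exact Or.inr (F.atoms_disjoint _ hB hA h)
  | succ n _ ih =>
    obtain ⟨C, hC, hBC⟩ := F.atoms_refine n B hB
    exact (ih hC).imp hBC.trans fun h => h.mono_left hBC

theorem subset_or_subset_or_disjoint (F : FiltrationAtoms Ω μ) {A B : Set Ω}
    (hA : A ∈ F.Atoms) (hB : B ∈ F.Atoms) : A ⊆ B ∨ B ⊆ A ∨ Disjoint A B := by
  obtain ⟨m, hm⟩ := mem_iUnion.1 hA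
  obtain ⟨n, hn⟩ := mem_iUnion.1 hB
  rcases le_total m n with h | h
  · rcases F.subset_or_disjoint_of_le h hm hn with h | h
    · exact Or.inr (Or.inl h)
    · exact Or.inr (Or.inr h.symm)
  · rcases F.subset_or_disjoint_of_le h hn hm with h | h
    · exact Or.inl h
    · exact Or.inr (Or.inr h)

theorem measurableSet_of_mem_atoms (F : FiltrationAtoms Ω μ) {A : Set Ω} (hA : A ∈ F.Atoms) :
    MeasurableSet A := by
  obtain ⟨n, hn⟩ := mem_iUnion.1 hA
  exact F.atoms_measurable n A hn

theorem IsAtomOrRing.measurableSet {F : FiltrationAtoms Ω μ} {R : Set Ω}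
    (hR : F.IsAtomOrRing R) : MeasurableSet R := by
  rcases hR with h | ⟨A, hA, B, hB, -, rfl, -⟩
  · exact F.measurableSet_of_mem_atoms h
  · exact (F.measurableSet_of_mem_atoms hA).diff (F.measurableSet_of_mem_atoms hB)

theorem IsAtomOrRing.exists_eq_diff {F : FiltrationAtoms Ω μ} {R : Set Ω}
    (hR : F.IsAtomOrRing R) :
    ∃ A ∈ F.Atoms, ∃ B, (B ∈ F.Atoms ∨ B = ∅) ∧ R = A \ B := by
  rcases hR with h | ⟨A, hA, B, hB, -, rfl, -⟩
  · exact ⟨R, h, ∅, Or.inr rfl, by simp⟩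
  · exact ⟨A, hA, B, Or.inl hB, rfl⟩

/-- Two disjoint atoms or rings cannot both be cut by the same atom. -/
theorem not_disjoint_of_cut (F : FiltrationAtoms Ω μ) {D R R' : Set Ω} (hD : D ∈ F.Atoms)
    (hR : F.IsAtomOrRing R) (hR' : F.IsAtomOrRing R')
    (hDR : (D ∩ R).Nonempty) (hRD : ¬ R ⊆ D) (hDR' : (D ∩ R').Nonempty) (hRD' : ¬ R' ⊆ D) :
    ¬ Disjoint R R' := by
  have nested : ∀ {X Y : Set Ω}, (X ∈ F.Atoms ∨ X = ∅) → (Y ∈ F.Atoms ∨ Y = ∅) →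
      X ⊆ Y ∨ Y ⊆ X ∨ Disjoint X Y := by
    rintro X Y (hX | rfl) (hY | rfl)
    · exact F.subset_or_subset_or_disjoint hX hY
    all_goals simp
  obtain ⟨A, hA, B, hB, rfl⟩ := hR.exists_eq_diff
  obtain ⟨A', hA', B', hB', rfl⟩ := hR'.exists_eq_diff
  have hAA' : A ⊆ A' ∨ A' ⊆ A ∨ Disjoint A A' := nested (Or.inl hA) (Or.inl hA')
  have hDA := nested (Or.inl hD) (Or.inl hA)
  have hDA' := nested (Or.inl hD) (Or.inl hA')
  have hDB := nested (Or.inl hD) hB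
  have hDB' := nested (Or.inl hD) hB'
  obtain ⟨x, hxD, hxA, hxB⟩ := hDR
  obtain ⟨y, hyD, hyA, hyB⟩ := hDR'
  obtain ⟨z, ⟨hzA, hzB⟩, hzD⟩ := not_subset.1 hRD
  obtain ⟨w, ⟨hwA, hwB⟩, hwD⟩ := not_subset.1 hRD'
  clear nested hR hR' hRD hRD' hA hA' hB hB' hD
  simp only [Set.disjoint_left, Set.mem_sdiff, Set.subset_def] at *
  have hDA : ∀ a ∈ D, a ∈ A := by grind
  have hDA' : ∀ a ∈ D, a ∈ A' := by grind
  intro h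
  have hx := @h x
  have hy := @h y
  have hz := @h z
  have hw := @h w
  grind

end FiltrationAtoms

section

variable {Ω : Type} [MeasurableSpace Ω] {μ : Measure Ω}

theorem Ep_le_eLpNorm (S : Submodule ℝ (Ω → ℝ)) (p : ℝ) (f : Ω → ℝ) (R : Set Ω) :
    Ep S p μ f R ≤ eLpNorm f (ENNReal.ofReal p) (μ.restrict R) := by
  refine (iInf₂_le 0 S.zero_mem).trans ?_
  rw [sub_zero]

theorem Ep_eq_zero_of_eqOn {S : Submodule ℝ (Ω → ℝ)} {p : ℝ} {f g : Ω → ℝ} {R : Set Ω}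
    (hR : MeasurableSet R) (hg : g ∈ S) (hfg : EqOn f g R) : Ep S p μ f R = 0 := by
  refine le_antisymm ((iInf₂_le g hg).trans (le_of_eq ?_)) zero_le
  have h : f - g =ᵐ[μ.restrict R] 0 := by
    filter_upwards [ae_restrict_mem hR] with x hx
    simp [hfg hx]
  rw [eLpNorm_congr_ae h, eLpNorm_zero]

/-- The error of a piecewise function on a ring vanishes unless one of the pieces cuts it. -/
theorem exists_cut_of_Ep_ne_zero {S : Submodule ℝ (Ω → ℝ)} {p : ℝ} {n : ℕ} {c : Fin n → ℝ}
    {h : Fin n → Ω → ℝ} {D : Fin n → Set Ω} {R : Set Ω} (hR : MeasurableSet R)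
    (hh : ∀ j, h j ∈ S) (hE : Ep S p μ (∑ j, c j • (D j).indicator (h j)) R ≠ 0) :
    ∃ j, (D j ∩ R).Nonempty ∧ ¬ R ⊆ D j := by
  contrapose! hE
  refine Ep_eq_zero_of_eqOn (g := ∑ j, if R ⊆ D j then c j • h j else 0) hR ?_ ?_
  · refine S.sum_mem fun j _ => ?_
    split_ifs
    · exact S.smul_mem _ (hh j)
    · exact S.zero_mem
  · intro x hx
    simp only [Finset.sum_apply]
    refine Finset.sum_congr rfl fun j _ => ?_
    by_cases hj : R ⊆ D j
    · simp [hj, hj hx]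
    · have hxD : x ∉ D j := fun hxD => hj (hE j ⟨x, hxD, hx⟩)
      simp [hj, hxD]

theorem sum_eLpNorm_restrict_rpow_le {p : ℝ} (hp : 0 < p) (f : Ω → ℝ) (P : Finset (Set Ω))
    (hP : ∀ R ∈ P, MeasurableSet R) (hd : (↑P : Set (Set Ω)).Pairwise Disjoint) :
    ∑ R ∈ P, eLpNorm f (ENNReal.ofReal p) (μ.restrict R) ^ p ≤
      eLpNorm f (ENNReal.ofReal p) μ ^ p := by
  have key : ∀ m : Measure Ω, eLpNorm f (ENNReal.ofReal p) m ^ p = ∫⁻ x, ‖f x‖ₑ ^ p ∂m := by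
    intro m
    rw [eLpNorm_eq_lintegral_rpow_enorm_toReal (by simpa using hp) ofReal_ne_top,
      toReal_ofReal hp.le, ← ENNReal.rpow_mul, one_div_mul_cancel hp.ne', ENNReal.rpow_one]
  simp only [key]
  rw [← lintegral_biUnion_finset (fun R hR R' hR' hne => hd hR hR' hne) hP]
  exact setLIntegral_le_lintegral _ _

theorem sum_rpow_rpow_le_card_rpow_mul {ι : Type*} (s : Finset ι) (a : ι → ℝ≥0∞) {σ p : ℝ}
    (hσ : 0 < σ) (hσp : σ < p) :
    (∑ i ∈ s, a i ^ σ) ^ (1 / σ) ≤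
      (s.card : ℝ≥0∞) ^ (1 / σ - 1 / p) * (∑ i ∈ s, a i ^ p) ^ (1 / p) := by
  have hp : 0 < p := hσ.trans hσp
  have h := ENNReal.rpow_sum_le_const_mul_sum_rpow s (fun i => a i ^ σ)
    ((one_le_div hσ).2 hσp.le)
  simp only [← ENNReal.rpow_mul, mul_div_cancel₀ p hσ.ne'] at h
  have h' := ENNReal.rpow_le_rpow h (one_div_pos.2 hp).le
  rw [ENNReal.mul_rpow_of_nonneg _ _ (one_div_pos.2 hp).le, ← ENNReal.rpow_mul,
    ← ENNReal.rpow_mul] at h'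
  convert h' using 3 <;> field_simp

end

/-- **Bernstein inequality.** For `0 < σ < p < ∞` and `β = 1/σ - 1/p` there is a
constant `c > 0` such that `|g|_{V_{σ,p}} ≤ c n^β ‖g‖_p` for every `n ≥ 1` and every
`g ∈ Σ_n^𝒞`. -/
theorem statement2
    {Ω : Type} [MeasurableSpace Ω] {μ : Measure Ω} [IsProbabilityMeasure μ]
    (F : FiltrationAtoms Ω μ) (ν : ℕ) (hν : 2 ≤ ν) (hFν : F.IsNuAry ν)
    (S : Submodule ℝ (Ω → ℝ)) (hSfin : Module.Finite ℝ S)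
    (hSmeas : ∀ g ∈ S, Measurable g) (hSbdd : ∀ g ∈ S, eLpNormEssSup g μ ≠ ∞)
    (hstab : StabilityCondition F S)
    (σ p : ℝ) (hσ : 0 < σ) (hσp : σ < p) :
    ∃ c : ℝ≥0∞, 0 < c ∧ c ≠ ∞ ∧ ∀ n : ℕ, 1 ≤ n → ∀ g ∈ SigmaN (dictC F S) n,
      varSeminorm F S σ p g ≤
        c * (n : ℝ≥0∞) ^ (1 / σ - 1 / p) * eLpNorm g (ENNReal.ofReal p) μ := by
  refine ⟨1, one_pos, one_ne_top, fun n hn g hg => ?_⟩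
  have hp : 0 < p := hσ.trans hσp
  have hβ : 0 ≤ 1 / σ - 1 / p := sub_nonneg.2 (one_div_le_one_div_of_le hσ hσp.le)
  obtain ⟨c, x, hx, rfl⟩ := hg
  choose h hhS D hD hxD using hx
  obtain rfl : x = fun j => (D j).indicator (h j) := funext hxD
  set g := ∑ j, c j • (D j).indicator (h j)
  rw [one_mul]
  refine iSup_le fun P => iSup_le fun hP => iSup_le fun hd => ?_
  set Q := P.filter fun R => Ep S p μ g R ≠ 0
  have hQP : Q ⊆ P := Finset.filter_subset _ _
  have hcut : ∀ R ∈ Q, ∃ j, (D j ∩ R).Nonempty ∧ ¬ R ⊆ D j := fun R hR =>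
    exists_cut_of_Ep_ne_zero (hP R (hQP hR)).measurableSet hhS (Finset.mem_filter.1 hR).2
  have : Nonempty (Fin n) := ⟨⟨0, hn⟩⟩
  choose! J hJ using hcut
  have hcard : Q.card ≤ n := by
    refine (Finset.card_le_card_of_injOn J (t := Finset.univ)
      (fun _ _ => Finset.mem_coe.2 (Finset.mem_univ _)) ?_).trans_eq (Finset.card_fin n)
    intro R hR R' hR' hJJ
    by_contra hne
    have h1 := hJ R hR
    have h2 := hJ R' hR'
    rw [← hJJ] at h2
    exact F.not_disjoint_of_cut (hD (J R)) (hP R (hQP hR)) (hP R' (hQP hR')) h1.1 h1.2 h2.1 h2.2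
      (hd (hQP hR) (hQP hR') hne)
  have hsum : ∑ R ∈ P, Ep S p μ g R ^ σ = ∑ R ∈ Q, Ep S p μ g R ^ σ := by
    refine (Finset.sum_subset hQP fun R hR hRQ => ?_).symm
    have h0 : Ep S p μ g R = 0 := by
      by_contra h0
      exact hRQ (Finset.mem_filter.2 ⟨hR, h0⟩)
    rw [h0, ENNReal.zero_rpow_of_pos hσ]
  have hle : ∑ R ∈ Q, Ep S p μ g R ^ p ≤ eLpNorm g (ENNReal.ofReal p) μ ^ p :=
    (Finset.sum_le_sum fun R _ => ENNReal.rpow_le_rpow (Ep_le_eLpNorm S p g R) hp.le).trans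
      (sum_eLpNorm_restrict_rpow_le hp g Q (fun R hR => (hP R (hQP hR)).measurableSet)
        (hd.mono (Finset.coe_subset.2 hQP)))
  rw [hsum]
  refine (sum_rpow_rpow_le_card_rpow_mul Q _ hσ hσp).trans ?_
  gcongr
  calc (∑ R ∈ Q, Ep S p μ g R ^ p) ^ (1 / p)
      ≤ (eLpNorm g (ENNReal.ofReal p) μ ^ p) ^ (1 / p) :=
        ENNReal.rpow_le_rpow hle (one_div_pos.2 hp).le
    _ = eLpNorm g (ENNReal.ofReal p) μ := by
        rw [← ENNReal.rpow_mul, mul_one_div_cancel hp.ne', ENNReal.rpow_one]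
end
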